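/- For x > 0, let α(x) be the weight sequence α_0 := √x and α_n := √((n+2)/(n+3)) for n ≥ 1, and let W_{α(x)} be the associated unilateral weighted shift on ℓ²(ℕ, ℂ). If W_{α(x)} is 3-hyponormal, then W_{α(x)} is quartically hyponormal. -/

import Mathlib

open scoped ComplexOrder
open ContinuousLinearMap

noncomputable section

variable {E : Type*} [NormedAddCommGroup E] [InnerProductSpace ℂ E] [CompleteSpace E]

/-- `T` is hyponormal: `‖T* x‖ ≤ ‖T x‖` for all `x`. -/
def Hyponormal (T : E →L[ℂ] E) : Prop :=
  ∀ x : E, ‖adjoint T x‖ ≤ ‖T x‖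

/-- `T` is `k`-hyponormal: `∑_{i,j=1}^k ⟨(T*^j T^i − T^i T*^j) x_j, x_i⟩ ≥ 0`. -/
def KHyponormal (k : ℕ) (T : E →L[ℂ] E) : Prop :=
  ∀ x : Fin k → E,
    (0 : ℂ) ≤ ∑ i, ∑ j,
      (inner ℂ (x i) ((adjoint T ^ (j.1 + 1) * T ^ (i.1 + 1)
        - T ^ (i.1 + 1) * adjoint T ^ (j.1 + 1)) (x j)) : ℂ)

/-- `T` is weakly `k`-hyponormal: every `∑_{j=1}^k λ_j T^j` is hyponormal. -/
def WeaklyKHyponormal (k : ℕ) (T : E →L[ℂ] E) : Prop :=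
  ∀ lam : Fin k → ℂ, Hyponormal (∑ j : Fin k, lam j • T ^ (j.1 + 1))

/-- The Hilbert space `ℓ²(ℕ, ℂ)`. -/
abbrev H : Type := lp (fun _ : ℕ => ℂ) 2

/-- The canonical orthonormal basis vectors of `ℓ²(ℕ, ℂ)`. -/
def e (n : ℕ) : H := lp.single 2 n 1

/-- `W` is the unilateral weighted shift with weight sequence `α`. -/
def IsWeightedShift (α : ℕ → ℝ) (W : H →L[ℂ] H) : Prop :=
  ∀ n : ℕ, W (e n) = (α n : ℂ) • e (n + 1)

/-- The weight sequence of Theorem 4: `α₀ = √x`, `α_n = √((n+2)/(n+3))` for `n ≥ 1`. -/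
def alphaX (x : ℝ) : ℕ → ℝ := fun n =>
  if n = 0 then Real.sqrt x else Real.sqrt (((n : ℝ) + 2) / ((n : ℝ) + 3))

/-- The weights `b` for which `W_{α(x)}` is, up to normalization, multiplication by `z` on the
space with `‖z ^ n‖ ^ 2 = b n`; they are extended by zero to the negative integers. -/
def shiftMoment (x : ℝ) (k : ℤ) : ℝ :=
  if k < 0 then 0 else if k = 0 then 1 / (3 * x) else 1 / ((k : ℝ) + 2)

theorem shiftMoment_of_neg (x : ℝ) {k : ℤ} (hk : k < 0) : shiftMoment x k = 0 := by
  simp [shiftMoment, hk]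

theorem shiftMoment_zero (x : ℝ) : shiftMoment x 0 = 1 / (3 * x) := by
  simp [shiftMoment]

theorem shiftMoment_of_pos (x : ℝ) {k : ℤ} (hk : 0 < k) :
    shiftMoment x k = 1 / ((k : ℝ) + 2) := by
  simp [shiftMoment, hk.ne', not_lt.2 hk.le]

theorem shiftMoment_pos {x : ℝ} (hx : 0 < x) {k : ℤ} (hk : 0 ≤ k) : 0 < shiftMoment x k := by
  rcases hk.eq_or_lt with rfl | hk
  · rw [shiftMoment_zero]; positivity
  · rw [shiftMoment_of_pos x hk]
    have : (0 : ℝ) < k := by exact_mod_cast hk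
    positivity

/-- The matrix of the self-commutator form on the component of angular degree `k`. -/
def commutatorCoeff (x : ℝ) (k : ℤ) (i j : Fin 4) : ℝ :=
  shiftMoment x (k + (i.1 + 1 : ℕ) + (j.1 + 1 : ℕ))
    - shiftMoment x (k + (i.1 + 1 : ℕ)) * shiftMoment x (k + (j.1 + 1 : ℕ)) / shiftMoment x k

/-- The real quadratic form with matrix `commutatorCoeff x k`. -/
def commutatorForm (x : ℝ) (k : ℤ) (y : Fin 4 → ℝ) : ℝ :=
  ∑ i, ∑ j, commutatorCoeff x k i j * (y i * y j)

theorem sum_cauchy_nonneg {m : ℕ} (n : ℕ) (w : Fin m → ℝ) :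
    0 ≤ ∑ i, ∑ j, w i * w j / ((n : ℝ) + i.1 + j.1 + 1) := by
  have key : ∫ t in (0 : ℝ)..1, t ^ n * (∑ i, w i * t ^ i.1) ^ 2
      = ∑ i, ∑ j, w i * w j / ((n : ℝ) + i.1 + j.1 + 1) := by
    have h1 : ∀ t : ℝ, t ^ n * (∑ i, w i * t ^ i.1) ^ 2
        = ∑ i, ∑ j, w i * w j * t ^ (n + i.1 + j.1) := by
      intro t
      rw [sq, Finset.sum_mul_sum, Finset.mul_sum]
      refine Finset.sum_congr rfl fun i _ => ?_
      rw [Finset.mul_sum]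
      refine Finset.sum_congr rfl fun j _ => ?_
      ring
    simp_rw [h1]
    rw [intervalIntegral.integral_finsetSum
      (fun i _ => (by fun_prop : Continuous _).intervalIntegrable _ _)]
    refine Finset.sum_congr rfl fun i _ => ?_
    rw [intervalIntegral.integral_finsetSum
      (fun i _ => (by fun_prop : Continuous _).intervalIntegrable _ _)]
    refine Finset.sum_congr rfl fun j _ => ?_
    rw [intervalIntegral.integral_const_mul, integral_pow]
    push_cast
    simp [div_eq_mul_inv]
  rw [← key]
  refine intervalIntegral.integral_nonneg zero_le_one fun t ht => ?_
  have := ht.1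
  positivity

theorem commutatorCoeff_of_pos (x : ℝ) {k : ℤ} (hk : 0 < k) (i j : Fin 4) :
    commutatorCoeff x k i j =
      (i.1 + 1) * (j.1 + 1) /
        (((k : ℝ) + 3 + i.1) * ((k : ℝ) + 3 + j.1) * ((k : ℝ) + 4 + i.1 + j.1)) := by
  have hk' : (0 : ℝ) < k := by exact_mod_cast hk
  have hi : (0 : ℝ) ≤ (i.1 : ℝ) := by positivity
  have hj : (0 : ℝ) ≤ (j.1 : ℝ) := by positivity
  rw [commutatorCoeff, shiftMoment_of_pos x (by omega), shiftMoment_of_pos x (by omega),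
    shiftMoment_of_pos x (by omega), shiftMoment_of_pos x hk]
  push_cast
  generalize (i.1 : ℝ) = s at *
  generalize (j.1 : ℝ) = t at *
  generalize (k : ℝ) = u at *
  have h1 : u + (s + 1) + (t + 1) + 2 ≠ 0 := by positivity
  have h2 : u + (s + 1) + 2 ≠ 0 := by positivity
  have h3 : u + (t + 1) + 2 ≠ 0 := by positivity
  have h4 : u + 2 ≠ 0 := by positivity
  have h5 : u + 3 + s ≠ 0 := by positivity
  have h6 : u + 3 + t ≠ 0 := by positivity
  have h7 : u + 4 + s + t ≠ 0 := by positivity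
  field_simp
  ring

theorem commutatorForm_nonneg_of_pos (x : ℝ) {k : ℤ} (hk : 0 < k) (y : Fin 4 → ℝ) :
    0 ≤ commutatorForm x k y := by
  lift k to ℕ using hk.le
  convert sum_cauchy_nonneg (k + 3) (fun i : Fin 4 => (i.1 + 1) * y i / ((k : ℝ) + 3 + i.1))
    using 1
  refine Finset.sum_congr rfl fun i _ => Finset.sum_congr rfl fun j _ => ?_
  rw [commutatorCoeff_of_pos x hk]
  push_cast
  have h7 : (k : ℝ) + 4 + i.1 + j.1 ≠ 0 := by positivity
  have h8 : (k : ℝ) + 3 + i.1 + j.1 + 1 ≠ 0 := by positivity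
  field_simp
  ring

theorem commutatorForm_one_ge (x : ℝ) (y : Fin 4 → ℝ) :
    1 / 300000 * y 0 ^ 2 ≤ commutatorForm x 1 y := by
  simp only [commutatorForm, commutatorCoeff_of_pos x one_pos, Fin.sum_univ_four]
  norm_num
  linarith [sq_nonneg (26243 * y 0 + 35000 * y 1 + 37500 * y 2 + 37500 * y 3),
    sq_nonneg (29712 * y 1 + 55935 * y 2 + 74680 * y 3), sq_nonneg (5515 * y 2 + 13656 * y 3),
    sq_nonneg (y 3)]

theorem commutatorForm_neg_one_ge (x : ℝ) (y : Fin 4 → ℝ) :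
    1 / 40000 * y 1 ^ 2 ≤ commutatorForm x (-1) y := by
  simp only [commutatorForm, commutatorCoeff, Fin.sum_univ_four]
  norm_num [shiftMoment]
  linarith [sq_nonneg (20 * y 0 + 15 * y 1 + 12 * y 2 + 10 * y 3),
    sq_nonneg (10479 * y 1 + 14000 * y 2 + 15000 * y 3), sq_nonneg (3712 * y 2 + 7185 * y 3),
    sq_nonneg (y 3)]

theorem commutatorForm_zero_ge {x : ℝ} (hx : x ≤ 200 / 297) (y : Fin 4 → ℝ) :
    1 / 60000 * (y 0 * y 1) ≤ commutatorForm x 0 y := by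
  have h1 : commutatorForm x 0 y = commutatorForm (200 / 297) 0 y
      + 3 * (200 / 297 - x) * (y 0 / 3 + y 1 / 4 + y 2 / 5 + y 3 / 6) ^ 2 := by
    simp only [commutatorForm, commutatorCoeff, Fin.sum_univ_four]
    norm_num [shiftMoment]
    ring_nf
    simp only [inv_inv]
  have h2 : 1 / 60000 * (y 0 * y 1) ≤ commutatorForm (200 / 297) 0 y := by
    simp only [commutatorForm, commutatorCoeff, Fin.sum_univ_four]
    norm_num [shiftMoment]
    linarith [sq_nonneg (6370000 * y 0 + 7893921 * y 1 + 7980000 * y 2 + 7640000 * y 3),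
      sq_nonneg (911789921 * y 1 + 1687980000 * y 2 + 2197640000 * y 3),
      sq_nonneg (1159515 * y 2 + 3000472 * y 3), sq_nonneg (y 3)]
  have h3 : 0 ≤ 3 * (200 / 297 - x) * (y 0 / 3 + y 1 / 4 + y 2 / 5 + y 3 / 6) ^ 2 :=
    mul_nonneg (by linarith) (sq_nonneg _)
  linarith

theorem commutatorForm_nonneg_of_lt_neg_one (x : ℝ) {k : ℤ} (hk : k < -1) (y : Fin 4 → ℝ)
    (hy : ∀ i : Fin 4, k + (i.1 + 1 : ℕ) < 0 → y i = 0) : 0 ≤ commutatorForm x k y := by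
  simp only [commutatorForm, commutatorCoeff, Fin.sum_univ_four,
    shiftMoment_of_neg x (hk.trans (by norm_num : (-1 : ℤ) < 0))]
  by_cases h5 : k < -4
  · have h : ∀ i, y i = 0 := fun i => hy i (by omega)
    simp [h]
  have h0 := hy 0 (by simp; omega)
  obtain rfl | rfl | rfl : k = -2 ∨ k = -3 ∨ k = -4 := by omega
  · norm_num [shiftMoment, h0]
    linarith [sq_nonneg (15 * y 1 + 12 * y 2 + 10 * y 3), sq_nonneg (7 * y 2 + 10 * y 3),
      sq_nonneg (y 3)]
  · have h1 := hy 1 (by simp)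
    norm_num [shiftMoment, h0, h1]
    linarith [sq_nonneg (6 * y 2 + 5 * y 3), sq_nonneg (y 3)]
  · have h1 := hy 1 (by simp)
    have h2 := hy 2 (by simp)
    norm_num [shiftMoment, h0, h1, h2]
    linarith [sq_nonneg (y 3)]

open scoped ComplexConjugate in
theorem re_sum_mul_conj_eq (m : Fin 4 → Fin 4 → ℝ) (z : Fin 4 → ℂ) :
    (∑ i, ∑ j, (m i j : ℂ) * (z i * conj (z j))).re =
      ∑ i, ∑ j, m i j * ((z i).re * (z j).re) + ∑ i, ∑ j, m i j * ((z i).im * (z j).im) := by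
  simp only [Complex.re_sum, ← Finset.sum_add_distrib]
  refine Finset.sum_congr rfl fun i _ => Finset.sum_congr rfl fun j _ => ?_
  simp
  ring

theorem alphaX_eq_div {x : ℝ} (hx : 0 < x) (n : ℕ) :
    alphaX x n = √(shiftMoment x (n + 1 : ℕ)) / √(shiftMoment x n) := by
  rw [← Real.sqrt_div (shiftMoment_pos hx (by positivity)).le, alphaX]
  rcases Nat.eq_zero_or_pos n with rfl | hn
  · rw [if_pos rfl, shiftMoment_of_pos x (by simp), Nat.cast_zero, shiftMoment_zero]
    congr 1
    push_cast
    field_simp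
    norm_num
  · rw [if_neg hn.ne', shiftMoment_of_pos x (by positivity), shiftMoment_of_pos x (by simpa)]
    congr 1
    push_cast
    field_simp
    ring

section WeightedShift

variable {x : ℝ} {W : H →L[ℂ] H}

theorem shift_pow_apply_e (hx : 0 < x) (hW : IsWeightedShift (alphaX x) W) (n j : ℕ) :
    (W ^ j) (e n) =
      ((√(shiftMoment x (n + j : ℕ)) / √(shiftMoment x n) : ℝ) : ℂ) • e (n + j) := by
  induction j with
  | zero =>
    have : √(shiftMoment x n) ≠ 0 := (Real.sqrt_pos.2 (shiftMoment_pos hx (by positivity))).ne'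
    simp [div_self this]
  | succ j ih =>
    have : √(shiftMoment x (n + j : ℕ)) ≠ 0 :=
      (Real.sqrt_pos.2 (shiftMoment_pos hx (by positivity))).ne'
    rw [pow_succ', mul_apply_eq_comp, ih, map_smul, hW, smul_smul,
      alphaX_eq_div hx, ← Complex.ofReal_mul, ← add_assoc]
    congr 2
    field_simp

theorem inner_e_left (n : ℕ) (f : H) : (inner ℂ (e n) f : ℂ) = f n := by
  rw [e, lp.inner_single_left]; simp

theorem e_apply (n m : ℕ) : (e n : ℕ → ℂ) m = if m = n then 1 else 0 := by
  rw [e, lp.single_apply, Pi.single_apply]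

/-- The coefficients of `f` in the unnormalized basis, extended by zero to the integers. -/
def shiftCoeff (x : ℝ) (f : H) (k : ℤ) : ℂ :=
  if k < 0 then 0 else f k.toNat / (√(shiftMoment x k) : ℝ)

theorem shiftCoeff_of_neg (f : H) {k : ℤ} (hk : k < 0) : shiftCoeff x f k = 0 := by
  simp [shiftCoeff, hk]

theorem shiftCoeff_natCast (f : H) (n : ℕ) :
    shiftCoeff x f n = f n / (√(shiftMoment x n) : ℝ) := by
  simp [shiftCoeff]

theorem adjoint_pow_eq (j : ℕ) : adjoint W ^ j = adjoint (W ^ j) := by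
  simp only [← ContinuousLinearMap.star_eq_adjoint, star_pow]

theorem adjoint_shift_pow_apply (hx : 0 < x) (hW : IsWeightedShift (alphaX x) W) (j : ℕ)
    (f : H) (n : ℕ) :
    ((adjoint W ^ j) f) n =
      ((√(shiftMoment x (n + j : ℕ)) / √(shiftMoment x n) : ℝ) : ℂ) * f (n + j) := by
  rw [adjoint_pow_eq, ← inner_e_left, adjoint_inner_right, shift_pow_apply_e hx hW,
    inner_smul_left, inner_e_left, Complex.conj_ofReal]

theorem shift_pow_apply (hx : 0 < x) (hW : IsWeightedShift (alphaX x) W) (j : ℕ)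
    (f : H) (n : ℕ) :
    ((W ^ j) f) n = (√(shiftMoment x n) : ℝ) * shiftCoeff x f ((n : ℤ) - j) := by
  rw [← inner_e_left, ← adjoint_inner_left, ← adjoint_pow_eq]
  have key : (adjoint W ^ j) (e n) =
      if j ≤ n then ((√(shiftMoment x n) / √(shiftMoment x (n - j : ℕ)) : ℝ) : ℂ) • e (n - j)
      else 0 := by
    ext m
    rw [adjoint_shift_pow_apply hx hW, e_apply]
    split_ifs with h1 h2 h2
    · have h3 : n - j = m := by omega
      rw [lp.coeFn_smul, Pi.smul_apply, e_apply, if_pos h3.symm, h3, h1]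
      simp
    · omega
    · rw [lp.coeFn_smul, Pi.smul_apply, e_apply, if_neg (by omega)]
      simp
    · simp
  rw [key]
  split_ifs with h
  · rw [inner_smul_left, inner_e_left, Complex.conj_ofReal, ← Nat.cast_sub h, shiftCoeff_natCast]
    push_cast
    ring
  · rw [inner_zero_left, shiftCoeff_of_neg _ (by omega), mul_zero]

open scoped ComplexConjugate in
theorem hasSum_inner_shift_pow (hx : 0 < x) (hW : IsWeightedShift (alphaX x) W) (i j : ℕ)
    (f : H) :
    HasSum (fun k : ℤ => (shiftMoment x (k + i + j) : ℂ) *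
      (shiftCoeff x f (k + i) * conj (shiftCoeff x f (k + j))))
      (inner ℂ ((W ^ i) f) ((W ^ j) f)) := by
  have h1 : HasSum (fun k : ℤ => (shiftMoment x k : ℂ) *
      (shiftCoeff x f (k - j) * conj (shiftCoeff x f (k - i))))
      (inner ℂ ((W ^ i) f) ((W ^ j) f)) := by
    rw [← Function.Injective.hasSum_iff (Nat.cast_injective (R := ℤ))]
    · refine (lp.hasSum_inner (𝕜 := ℂ) ((W ^ i) f) ((W ^ j) f)).congr_fun fun n => ?_
      rw [shift_pow_apply hx hW, shift_pow_apply hx hW, RCLike.inner_apply, map_mul,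
        Complex.conj_ofReal, Function.comp_apply]
      have h2 : (shiftMoment x n : ℂ) = (√(shiftMoment x n) : ℝ) * (√(shiftMoment x n) : ℝ) := by
        rw [← Complex.ofReal_mul, Real.mul_self_sqrt (shiftMoment_pos hx (by positivity)).le]
      rw [h2]
      ring
    · intro k hk
      have : k < 0 := by
        by_contra h
        exact hk ⟨k.toNat, by simpa using h⟩
      rw [shiftMoment_of_neg x this]
      simp
  rw [← (Equiv.addRight ((i : ℤ) + j)).hasSum_iff] at h1
  refine h1.congr_fun fun k => ?_
  have e1 : k + (i + j : ℤ) - j = k + i := by ring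
  have e2 : k + (i + j : ℤ) - i = k + j := by ring
  rw [Function.comp_apply, Equiv.coe_addRight, e1, e2, add_assoc]

open scoped ComplexConjugate in
theorem hasSum_inner_adjoint_shift_pow (hx : 0 < x) (hW : IsWeightedShift (alphaX x) W)
    (i j : ℕ) (f : H) :
    HasSum (fun k : ℤ =>
      ((shiftMoment x (k + i) * shiftMoment x (k + j) / shiftMoment x k : ℝ) : ℂ) *
      (shiftCoeff x f (k + i) * conj (shiftCoeff x f (k + j))))
      (inner ℂ ((adjoint W ^ j) f) ((adjoint W ^ i) f)) := by
  rw [← Function.Injective.hasSum_iff (Nat.cast_injective (R := ℤ))]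
  · refine (lp.hasSum_inner (𝕜 := ℂ) ((adjoint W ^ j) f) ((adjoint W ^ i) f)).congr_fun
      fun n => ?_
    have hs : ∀ m : ℕ, ((√(shiftMoment x m) : ℝ) : ℂ) ≠ 0 := fun m => by
      exact_mod_cast (Real.sqrt_pos.2 (shiftMoment_pos hx (by positivity))).ne'
    have h2 : ∀ m : ℕ,
        (shiftMoment x m : ℂ) = (√(shiftMoment x m) : ℝ) * (√(shiftMoment x m) : ℝ) := fun m => by
      rw [← Complex.ofReal_mul, Real.mul_self_sqrt (shiftMoment_pos hx (by positivity)).le]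
    rw [adjoint_shift_pow_apply hx hW, adjoint_shift_pow_apply hx hW, RCLike.inner_apply, map_mul,
      Complex.conj_ofReal, Function.comp_apply, ← Nat.cast_add, ← Nat.cast_add,
      shiftCoeff_natCast, shiftCoeff_natCast, map_div₀, Complex.conj_ofReal]
    simp only [Complex.ofReal_mul, Complex.ofReal_div, h2]
    have := hs n
    have := hs (n + i)
    have := hs (n + j)
    field_simp
  · intro k hk
    have : k < 0 := by
      by_contra h
      exact hk ⟨k.toNat, by simpa using h⟩
    rw [shiftMoment_of_neg x this]
    simp

theorem adjoint_shift_pow_apply_e_self (hx : 0 < x) (hW : IsWeightedShift (alphaX x) W) (n : ℕ) :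
    (adjoint W ^ n) (e n) = ((√(shiftMoment x n) / √(shiftMoment x 0) : ℝ) : ℂ) • e 0 := by
  ext m
  rw [adjoint_shift_pow_apply hx hW, e_apply, lp.coeFn_smul, Pi.smul_apply, e_apply]
  rcases Nat.eq_zero_or_pos m with rfl | hm
  · simp
  · simp [hm.ne']

theorem inner_crossCommutator_e (hx : 0 < x) (hW : IsWeightedShift (alphaX x) W) (p q : ℕ) :
    (inner ℂ (((√(shiftMoment x p) : ℝ) : ℂ) • e p)
      ((adjoint W ^ q * W ^ p - W ^ p * adjoint W ^ q) (((√(shiftMoment x q) : ℝ) : ℂ) • e q)) : ℂ)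
      = ((shiftMoment x (p + q : ℕ) -
        shiftMoment x p * shiftMoment x q / shiftMoment x 0 : ℝ) : ℂ) := by
  have hs : ∀ m : ℕ, √(shiftMoment x m) ≠ 0 := fun m =>
    (Real.sqrt_pos.2 (shiftMoment_pos hx (by positivity))).ne'
  have h2 : ∀ m : ℕ, shiftMoment x m = √(shiftMoment x m) ^ 2 := fun m =>
    (Real.sq_sqrt (shiftMoment_pos hx (by positivity)).le).symm
  rw [sub_apply, mul_apply_eq_comp, mul_apply_eq_comp, inner_sub_right]
  have e1 : (inner ℂ (((√(shiftMoment x p) : ℝ) : ℂ) • e p)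
      ((adjoint W ^ q) ((W ^ p) (((√(shiftMoment x q) : ℝ) : ℂ) • e q))) : ℂ)
      = ((shiftMoment x (p + q : ℕ) : ℝ) : ℂ) := by
    rw [adjoint_pow_eq, adjoint_inner_right, map_smul, map_smul, shift_pow_apply_e hx hW,
      shift_pow_apply_e hx hW, add_comm q p]
    simp only [inner_smul_left, inner_smul_right, inner_e_left, e_apply, if_true,
      Complex.conj_ofReal, mul_one, ← Complex.ofReal_mul]
    congr 1
    have := hs p
    have := hs q
    field_simp
    exact (h2 (p + q)).symm
  have e2 : (inner ℂ (((√(shiftMoment x p) : ℝ) : ℂ) • e p)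
      ((W ^ p) ((adjoint W ^ q) (((√(shiftMoment x q) : ℝ) : ℂ) • e q))) : ℂ)
      = ((shiftMoment x p * shiftMoment x q / shiftMoment x 0 : ℝ) : ℂ) := by
    rw [← adjoint_inner_left, ← adjoint_pow_eq, map_smul, map_smul,
      adjoint_shift_pow_apply_e_self hx hW, adjoint_shift_pow_apply_e_self hx hW]
    simp only [inner_smul_left, inner_smul_right, inner_e_left, e_apply, if_true,
      Complex.conj_ofReal, mul_one, ← Complex.ofReal_mul]
    congr 1
    have h0 := h2 0
    have h3 := hs 0
    rw [Nat.cast_zero] at h0 h3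
    rw [h2 p, h2 q, h0]
    simp only [Real.sqrt_sq (Real.sqrt_nonneg _)]
    field_simp
  rw [e1, e2, Complex.ofReal_sub]

theorem le_of_threeHyponormal (hx : 0 < x) (hW : IsWeightedShift (alphaX x) W)
    (h : KHyponormal 3 W) : x ≤ 200 / 297 := by
  have h1 := h fun i => ((![600, -1050, 560] i : ℝ) : ℂ) •
    ((√(shiftMoment x (i.1 + 1 : ℕ)) : ℝ) : ℂ) • e (i.1 + 1)
  simp only [map_smul _ ((![600, -1050, 560] _ : ℝ) : ℂ), inner_smul_left, inner_smul_right,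
    inner_crossCommutator_e hx hW, Complex.conj_ofReal, ← Complex.ofReal_mul,
    ← Complex.ofReal_sum, Complex.zero_le_real] at h1
  simp only [Fin.sum_univ_three, Matrix.cons_val] at h1
  norm_num [shiftMoment] at h1
  ring_nf at h1
  simp only [inv_inv] at h1
  linarith

theorem hasSum_selfCommutator (hx : 0 < x) (hW : IsWeightedShift (alphaX x) W) (lam : Fin 4 → ℂ)
    (f : H) :
    HasSum (fun k : ℤ =>
      commutatorForm x k
        (fun i => (star (lam i) * shiftCoeff x f (k + (i.1 + 1 : ℕ))).re) +
      commutatorForm x k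
        (fun i => (star (lam i) * shiftCoeff x f (k + (i.1 + 1 : ℕ))).im))
      (‖(∑ j : Fin 4, lam j • W ^ (j.1 + 1)) f‖ ^ 2 -
        ‖adjoint (∑ j : Fin 4, lam j • W ^ (j.1 + 1)) f‖ ^ 2) := by
  have hadj : adjoint (∑ j : Fin 4, lam j • W ^ (j.1 + 1)) =
      ∑ j : Fin 4, star (lam j) • adjoint W ^ (j.1 + 1) := by
    simp only [← ContinuousLinearMap.star_eq_adjoint, star_sum, star_smul, star_pow]
  have h1 : HasSum (fun k : ℤ => ∑ i : Fin 4, ∑ j : Fin 4, (commutatorCoeff x k i j : ℂ) *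
      ((star (lam i) * shiftCoeff x f (k + (i.1 + 1 : ℕ))) *
        star (star (lam j) * shiftCoeff x f (k + (j.1 + 1 : ℕ)))))
      (∑ i : Fin 4, ∑ j : Fin 4, star (lam i) * lam j *
        (inner ℂ ((W ^ (i.1 + 1)) f) ((W ^ (j.1 + 1)) f) -
          inner ℂ ((adjoint W ^ (j.1 + 1)) f) ((adjoint W ^ (i.1 + 1)) f))) := by
    refine hasSum_sum fun i _ => hasSum_sum fun j _ => ?_
    refine (((hasSum_inner_shift_pow hx hW (i.1 + 1) (j.1 + 1) f).sub
      (hasSum_inner_adjoint_shift_pow hx hW (i.1 + 1) (j.1 + 1) f)).mul_left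
        (star (lam i) * lam j)).congr_fun fun k => ?_
    simp only [commutatorCoeff, star_mul', star_star, Complex.ofReal_sub, starRingEnd_apply]
    ring
  have h2 := Complex.hasSum_re h1
  have h3 : (∑ i : Fin 4, ∑ j : Fin 4, star (lam i) * lam j *
        (inner ℂ ((W ^ (i.1 + 1)) f) ((W ^ (j.1 + 1)) f) -
          inner ℂ ((adjoint W ^ (j.1 + 1)) f) ((adjoint W ^ (i.1 + 1)) f)) : ℂ).re =
      ‖(∑ j : Fin 4, lam j • W ^ (j.1 + 1)) f‖ ^ 2 -
        ‖adjoint (∑ j : Fin 4, lam j • W ^ (j.1 + 1)) f‖ ^ 2 := by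
    rw [← inner_self_eq_norm_sq (𝕜 := ℂ), ← inner_self_eq_norm_sq (𝕜 := ℂ), hadj]
    simp only [sum_apply, smul_apply, sum_inner, inner_sum,
      inner_smul_left, inner_smul_right, mul_sub, Finset.sum_sub_distrib,
      Finset.mul_sum]
    rw [← RCLike.re_eq_complex_re, map_sub]
    congr 2
    · rw [Finset.sum_comm]
      refine Finset.sum_congr rfl fun i _ => Finset.sum_congr rfl fun j _ => ?_
      simp only [starRingEnd_apply]
      ring
    · refine Finset.sum_congr rfl fun i _ => Finset.sum_congr rfl fun j _ => ?_
      simp only [starRingEnd_apply, star_star]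
      ring
  rw [h3] at h2
  exact h2.congr_fun fun k => (re_sum_mul_conj_eq _ _).symm

end WeightedShift

/-- If `W_{α(x)}` is `3`-hyponormal, then it is quartically hyponormal. -/
theorem quartically_hyponormal_of_threeHyponormal (x : ℝ) (hx : 0 < x)
    (W : H →L[ℂ] H) (hW : IsWeightedShift (alphaX x) W)
    (h : KHyponormal 3 W) : WeaklyKHyponormal 4 W := by
  have hx' := le_of_threeHyponormal hx hW h
  intro lam f
  have hS := hasSum_selfCommutator hx hW lam f
  set a : ℤ → ℂ := shiftCoeff x f with ha
  set X : ℝ := ‖star (lam 0) * a 2‖ with hX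
  set Y : ℝ := ‖star (lam 1) * a 1‖ with hY
  have hXsq : X ^ 2 = (star (lam 0) * a 2).re ^ 2 + (star (lam 0) * a 2).im ^ 2 := by
    rw [hX, Complex.sq_norm, Complex.normSq_apply]; ring
  have hYsq : Y ^ 2 = (star (lam 1) * a 1).re ^ 2 + (star (lam 1) * a 1).im ^ 2 := by
    rw [hY, Complex.sq_norm, Complex.normSq_apply]; ring
  have hXY : -(X * Y) ≤ (star (lam 0) * a 1).re * (star (lam 1) * a 2).re +
      (star (lam 0) * a 1).im * (star (lam 1) * a 2).im := by
    have h1 : X * Y = ‖(star (lam 0) * a 1) * star (star (lam 1) * a 2)‖ := by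
      simp only [hX, hY, norm_mul, norm_star]
      ring
    have h2 := (abs_le.1 (Complex.abs_re_le_norm
      ((star (lam 0) * a 1) * star (star (lam 1) * a 2)))).1
    rw [← h1, Complex.mul_re] at h2
    simp only [Complex.star_def] at h2 ⊢
    rw [Complex.conj_re, Complex.conj_im] at h2
    linarith
  have hB : HasSum (fun k : ℤ => if k = 1 then 1 / 300000 * X ^ 2 else
      if k = -1 then 1 / 40000 * Y ^ 2 else if k = 0 then -(1 / 60000 * (X * Y)) else 0)
      (1 / 300000 * X ^ 2 + (1 / 40000 * Y ^ 2 + -(1 / 60000 * (X * Y)))) := by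
    convert! hasSum_sum_of_ne_finset_zero (s := {1, -1, 0}) (f := fun k : ℤ =>
      if k = 1 then 1 / 300000 * X ^ 2 else
        if k = -1 then 1 / 40000 * Y ^ 2 else if k = 0 then -(1 / 60000 * (X * Y)) else 0) ?_
      using 1
    · norm_num
    · intro k hk
      simp only [Finset.mem_insert, Finset.mem_singleton, not_or] at hk
      simp [hk]
    · infer_instance
  have hle := hasSum_le (fun k => ?_) hB hS
  · have : 0 ≤ 1 / 300000 * X ^ 2 + (1 / 40000 * Y ^ 2 + -(1 / 60000 * (X * Y))) := by
      nlinarith [sq_nonneg (X - 5 / 2 * Y), sq_nonneg Y]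
    exact (sq_le_sq₀ (norm_nonneg _) (norm_nonneg _)).1 (by linarith)
  · split_ifs with h1 h2 h3
    · subst h1
      have hre := commutatorForm_one_ge x
        fun i => (star (lam i) * a (1 + (i.1 + 1 : ℕ))).re
      have him := commutatorForm_one_ge x
        fun i => (star (lam i) * a (1 + (i.1 + 1 : ℕ))).im
      refine le_trans (le_of_eq ?_) (add_le_add hre him)
      rw [hXsq, mul_add]
      rfl
    · subst h2
      have hre := commutatorForm_neg_one_ge x
        fun i => (star (lam i) * a (-1 + (i.1 + 1 : ℕ))).re
      have him := commutatorForm_neg_one_ge x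
        fun i => (star (lam i) * a (-1 + (i.1 + 1 : ℕ))).im
      refine le_trans (le_of_eq ?_) (add_le_add hre him)
      rw [hYsq, mul_add]
      rfl
    · subst h3
      have hre := commutatorForm_zero_ge hx'
        fun i => (star (lam i) * a (0 + (i.1 + 1 : ℕ))).re
      have him := commutatorForm_zero_ge hx'
        fun i => (star (lam i) * a (0 + (i.1 + 1 : ℕ))).im
      refine le_trans ?_ (add_le_add hre him)
      rw [← mul_add, ← mul_neg]
      exact mul_le_mul_of_nonneg_left hXY (by norm_num)
    · rcases lt_or_ge k (-1) with hk | hk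
      · have hz : ∀ i : Fin 4, k + (i.1 + 1 : ℕ) < 0 →
            star (lam i) * a (k + (i.1 + 1 : ℕ)) = 0 := fun i hi => by
          rw [ha, shiftCoeff_of_neg _ hi, mul_zero]
        refine add_nonneg (commutatorForm_nonneg_of_lt_neg_one x hk _ fun i hi => ?_)
          (commutatorForm_nonneg_of_lt_neg_one x hk _ fun i hi => ?_)
        · rw [hz i hi, Complex.zero_re]
        · rw [hz i hi, Complex.zero_im]
      · exact add_nonneg (commutatorForm_nonneg_of_pos x (by omega) _)
          (commutatorForm_nonneg_of_pos x (by omega) _)
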